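/- (Theorem 4.1, second part) Let T be an invertible block TBT-matrix belonging to the DSTU class. Then G₂₁ = Ũ₁ G₁₂^τ Ũ₂, where Ũ_k = [[0, −U_k⊗U₃],[U_k⊗U₃, 0]]. -/

import Mathlib

open Matrix Kronecker BigOperators

noncomputable section

namespace TBT

/-- The entries `a_r` of the matrices `𝒜_p`. -/
def aEnt (r : ℤ) : ℂ := if r < 0 then 0 else if r = 0 then Complex.I / 2 else Complex.I

/-- The `n × n` matrix `𝒜 = {a_{j-ℓ}}`. -/
def calA (n : ℕ) : Matrix (Fin n) (Fin n) ℂ :=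
  Matrix.of fun j ℓ => aEnt (((j : ℕ) : ℤ) - ((ℓ : ℕ) : ℤ))

/-- The index type of the `m × m` matrices, `m = m₁ m₂ m₃`. -/
abbrev Idx (m₁ m₂ m₃ : ℕ) := (Fin m₁ × Fin m₂) × Fin m₃

/-- `A₁ = 𝒜₁ ⊗ I_{m₂} ⊗ I_{m₃}`. -/
def A1 (m₁ m₂ m₃ : ℕ) : Matrix (Idx m₁ m₂ m₃) (Idx m₁ m₂ m₃) ℂ :=
  (calA m₁ ⊗ₖ (1 : Matrix (Fin m₂) (Fin m₂) ℂ)) ⊗ₖ (1 : Matrix (Fin m₃) (Fin m₃) ℂ)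

/-- `A₂ = I_{m₁} ⊗ 𝒜₂ ⊗ I_{m₃}`. -/
def A2 (m₁ m₂ m₃ : ℕ) : Matrix (Idx m₁ m₂ m₃) (Idx m₁ m₂ m₃) ℂ :=
  ((1 : Matrix (Fin m₁) (Fin m₁) ℂ) ⊗ₖ calA m₂) ⊗ₖ (1 : Matrix (Fin m₃) (Fin m₃) ℂ)

/-- `A₃ = I_{m₁} ⊗ I_{m₂} ⊗ 𝒜₃`. -/
def A3 (m₁ m₂ m₃ : ℕ) : Matrix (Idx m₁ m₂ m₃) (Idx m₁ m₂ m₃) ℂ :=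
  ((1 : Matrix (Fin m₁) (Fin m₁) ℂ) ⊗ₖ (1 : Matrix (Fin m₂) (Fin m₂) ℂ)) ⊗ₖ calA m₃

/-- The block TBT-matrix `T = {𝒯_{i-k}}`, `𝒯_r = {t^{(r)}_{i-k}}`, built from the
data `t : ℤ → ℤ → Matrix (Fin m₃) (Fin m₃) ℂ` of its `m₃ × m₃` blocks. -/
def Tmat (m₁ m₂ m₃ : ℕ) (t : ℤ → ℤ → Matrix (Fin m₃) (Fin m₃) ℂ) :
    Matrix (Idx m₁ m₂ m₃) (Idx m₁ m₂ m₃) ℂ :=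
  Matrix.of fun x y =>
    t (((x.1.1 : ℕ) : ℤ) - ((y.1.1 : ℕ) : ℤ)) (((x.1.2 : ℕ) : ℤ) - ((y.1.2 : ℕ) : ℤ)) x.2 y.2

/-- The Toeplitz blocks `𝒯_r = {t^{(r)}_{i-k}}` of a block TBT-matrix. -/
def calT (m₂ m₃ : ℕ) (t : ℤ → ℤ → Matrix (Fin m₃) (Fin m₃) ℂ) (r : ℤ) :
    Matrix (Fin m₂ × Fin m₃) (Fin m₂ × Fin m₃) ℂ :=
  Matrix.of fun x y => t r (((x.1 : ℕ) : ℤ) - ((y.1 : ℕ) : ℤ)) x.2 y.2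

/-- `M₁₁ = col [M₁₁⁽¹⁾ … M₁₁⁽ᵐ¹⁾]`, `M₁₁⁽ⁱ⁾ = (1/2)𝒯₀ + Σ_{s=1}^{i-1} 𝒯_s`. -/
def M11 (m₁ m₂ m₃ : ℕ) (t : ℤ → ℤ → Matrix (Fin m₃) (Fin m₃) ℂ) :
    Matrix (Idx m₁ m₂ m₃) (Fin m₂ × Fin m₃) ℂ :=
  Matrix.of fun x y =>
    ((2 : ℂ)⁻¹ • calT m₂ m₃ t 0 +
      ∑ s ∈ Finset.range (x.1.1 : ℕ), calT m₂ m₃ t ((s : ℤ) + 1)) (x.1.2, x.2) y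

/-- `M₂₁ = 1_{m₁}^* ⊗ I_{m₂ m₃}`. -/
def M21 (m₁ m₂ m₃ : ℕ) : Matrix (Fin m₂ × Fin m₃) (Idx m₁ m₂ m₃) ℂ :=
  Matrix.of fun y x => if y.1 = x.1.2 ∧ y.2 = x.2 then 1 else 0

/-- `M₃₁ = M₂₁^*`. -/
def M31 (m₁ m₂ m₃ : ℕ) : Matrix (Idx m₁ m₂ m₃) (Fin m₂ × Fin m₃) ℂ := (M21 m₁ m₂ m₃)ᴴ

/-- `M₄₁ = [M₄₁⁽¹⁾ … M₄₁⁽ᵐ¹⁾]`, `M₄₁⁽ᵏ⁾ = (1/2)𝒯₀ + Σ_{s=1}^{k-1} 𝒯_{-s}`. -/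
def M41 (m₁ m₂ m₃ : ℕ) (t : ℤ → ℤ → Matrix (Fin m₃) (Fin m₃) ℂ) :
    Matrix (Fin m₂ × Fin m₃) (Idx m₁ m₂ m₃) ℂ :=
  Matrix.of fun y x =>
    ((2 : ℂ)⁻¹ • calT m₂ m₃ t 0 +
      ∑ s ∈ Finset.range (x.1.1 : ℕ), calT m₂ m₃ t (-((s : ℤ) + 1))) y (x.1.2, x.2)

/-- The blocks `M₁₂⁽ʳ⁾ = col [(1/2)t₀⁽ʳ⁾, (1/2)t₀⁽ʳ⁾ + t₁⁽ʳ⁾, …]`. -/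
def M12blk (m₂ m₃ : ℕ) (t : ℤ → ℤ → Matrix (Fin m₃) (Fin m₃) ℂ) (r : ℤ) :
    Matrix (Fin m₂ × Fin m₃) (Fin m₃) ℂ :=
  Matrix.of fun x l =>
    ((2 : ℂ)⁻¹ • t r 0 + ∑ j ∈ Finset.range (x.1 : ℕ), t r ((j : ℤ) + 1)) x.2 l

/-- `M₁₂ = {M₁₂^{(i-k)}}_{i,k=1}^{m₁}`. -/
def M12 (m₁ m₂ m₃ : ℕ) (t : ℤ → ℤ → Matrix (Fin m₃) (Fin m₃) ℂ) :
    Matrix (Idx m₁ m₂ m₃) (Fin m₁ × Fin m₃) ℂ :=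
  Matrix.of fun x y => M12blk m₂ m₃ t (((x.1.1 : ℕ) : ℤ) - ((y.1 : ℕ) : ℤ)) (x.1.2, x.2) y.2

/-- `M₂₂ = I_{m₁} ⊗ 1_{m₂}^* ⊗ I_{m₃}`. -/
def M22 (m₁ m₂ m₃ : ℕ) : Matrix (Fin m₁ × Fin m₃) (Idx m₁ m₂ m₃) ℂ :=
  Matrix.of fun y x => if y.1 = x.1.1 ∧ y.2 = x.2 then 1 else 0

/-- `M₃₂ = M₂₂^*`. -/
def M32 (m₁ m₂ m₃ : ℕ) : Matrix (Idx m₁ m₂ m₃) (Fin m₁ × Fin m₃) ℂ := (M22 m₁ m₂ m₃)ᴴ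

/-- The blocks `M₄₂⁽ʳ⁾ = [(1/2)t₀⁽ʳ⁾, (1/2)t₀⁽ʳ⁾ + t₋₁⁽ʳ⁾, …]`. -/
def M42blk (m₂ m₃ : ℕ) (t : ℤ → ℤ → Matrix (Fin m₃) (Fin m₃) ℂ) (r : ℤ) :
    Matrix (Fin m₃) (Fin m₂ × Fin m₃) ℂ :=
  Matrix.of fun l x =>
    ((2 : ℂ)⁻¹ • t r 0 + ∑ j ∈ Finset.range (x.1 : ℕ), t r (-((j : ℤ) + 1))) l x.2

/-- `M₄₂ = {M₄₂^{(i-k)}}_{i,k=1}^{m₁}`. -/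
def M42 (m₁ m₂ m₃ : ℕ) (t : ℤ → ℤ → Matrix (Fin m₃) (Fin m₃) ℂ) :
    Matrix (Fin m₁ × Fin m₃) (Idx m₁ m₂ m₃) ℂ :=
  Matrix.of fun y x => M42blk m₂ m₃ t (((y.1 : ℕ) : ℤ) - ((x.1.1 : ℕ) : ℤ)) y.2 (x.1.2, x.2)

/-- `Π₁ = [M₁₁ M₃₁]`. -/
def Pi1 (m₁ m₂ m₃ : ℕ) (t : ℤ → ℤ → Matrix (Fin m₃) (Fin m₃) ℂ) :
    Matrix (Idx m₁ m₂ m₃) ((Fin m₂ × Fin m₃) ⊕ (Fin m₂ × Fin m₃)) ℂ :=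
  Matrix.fromCols (M11 m₁ m₂ m₃ t) (M31 m₁ m₂ m₃)

/-- `Π₂ = [M₁₂ M₃₂]`. -/
def Pi2 (m₁ m₂ m₃ : ℕ) (t : ℤ → ℤ → Matrix (Fin m₃) (Fin m₃) ℂ) :
    Matrix (Idx m₁ m₂ m₃) ((Fin m₁ × Fin m₃) ⊕ (Fin m₁ × Fin m₃)) ℂ :=
  Matrix.fromCols (M12 m₁ m₂ m₃ t) (M32 m₁ m₂ m₃)

/-- `Π̂₁ = col [M₂₁; M₄₁]`. -/
def Pihat1 (m₁ m₂ m₃ : ℕ) (t : ℤ → ℤ → Matrix (Fin m₃) (Fin m₃) ℂ) :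
    Matrix ((Fin m₂ × Fin m₃) ⊕ (Fin m₂ × Fin m₃)) (Idx m₁ m₂ m₃) ℂ :=
  Matrix.fromRows (M21 m₁ m₂ m₃) (M41 m₁ m₂ m₃ t)

/-- `Π̂₂ = col [M₂₂; M₄₂]`. -/
def Pihat2 (m₁ m₂ m₃ : ℕ) (t : ℤ → ℤ → Matrix (Fin m₃) (Fin m₃) ℂ) :
    Matrix ((Fin m₁ × Fin m₃) ⊕ (Fin m₁ × Fin m₃)) (Idx m₁ m₂ m₃) ℂ :=
  Matrix.fromRows (M22 m₁ m₂ m₃) (M42 m₁ m₂ m₃ t)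

/-- `Γ₁ = T⁻¹ Π₁`. -/
def Gamma1 (m₁ m₂ m₃ : ℕ) (t : ℤ → ℤ → Matrix (Fin m₃) (Fin m₃) ℂ) :
    Matrix (Idx m₁ m₂ m₃) ((Fin m₂ × Fin m₃) ⊕ (Fin m₂ × Fin m₃)) ℂ :=
  (Tmat m₁ m₂ m₃ t)⁻¹ * Pi1 m₁ m₂ m₃ t

/-- `Γ₂ = T⁻¹ Π₂`. -/
def Gamma2 (m₁ m₂ m₃ : ℕ) (t : ℤ → ℤ → Matrix (Fin m₃) (Fin m₃) ℂ) :
    Matrix (Idx m₁ m₂ m₃) ((Fin m₁ × Fin m₃) ⊕ (Fin m₁ × Fin m₃)) ℂ :=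
  (Tmat m₁ m₂ m₃ t)⁻¹ * Pi2 m₁ m₂ m₃ t

/-- `Γ̂₁ = Π̂₁ T⁻¹`. -/
def Gammahat1 (m₁ m₂ m₃ : ℕ) (t : ℤ → ℤ → Matrix (Fin m₃) (Fin m₃) ℂ) :
    Matrix ((Fin m₂ × Fin m₃) ⊕ (Fin m₂ × Fin m₃)) (Idx m₁ m₂ m₃) ℂ :=
  Pihat1 m₁ m₂ m₃ t * (Tmat m₁ m₂ m₃ t)⁻¹

/-- `Γ̂₂ = Π̂₂ T⁻¹`. -/
def Gammahat2 (m₁ m₂ m₃ : ℕ) (t : ℤ → ℤ → Matrix (Fin m₃) (Fin m₃) ℂ) :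
    Matrix ((Fin m₁ × Fin m₃) ⊕ (Fin m₁ × Fin m₃)) (Idx m₁ m₂ m₃) ℂ :=
  Pihat2 m₁ m₂ m₃ t * (Tmat m₁ m₂ m₃ t)⁻¹

/-- `ℒ = 1_{m₁m₂} ⊗ I_{m₃}`. -/
def Lmat (m₁ m₂ m₃ : ℕ) : Matrix (Idx m₁ m₂ m₃) (Fin m₃) ℂ :=
  Matrix.of fun x l => if x.2 = l then 1 else 0

/-- `ℒ_p = 1_{m_p} ⊗ I_{m₃}`. -/
def Lp (n m₃ : ℕ) : Matrix (Fin n × Fin m₃) (Fin m₃) ℂ :=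
  Matrix.of fun x l => if x.2 = l then 1 else 0

/-- A row vector `v` Kronecker the identity `I_{m₃}`. -/
def rowKronId {n : Type*} (m₃ : ℕ) (v : n → ℂ) : Matrix (Fin m₃) (n × Fin m₃) ℂ :=
  Matrix.of fun l x => v x.1 * (if l = x.2 then 1 else 0)

/-- A column vector `v` Kronecker the identity `I_{m₃}`. -/
def colKronId {n : Type*} (m₃ : ℕ) (v : n → ℂ) : Matrix (n × Fin m₃) (Fin m₃) ℂ :=
  Matrix.of fun x l => v x.1 * (if x.2 = l then 1 else 0)

/-- `ω(λ,μ) = ℒ^* (A₁^*-μ₁I)⁻¹ (A₂^*-μ₂I)⁻¹ T⁻¹ (A₁-λ₁I)⁻¹ (A₂-λ₂I)⁻¹ ℒ`. -/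
def omegaF (m₁ m₂ m₃ : ℕ) (t : ℤ → ℤ → Matrix (Fin m₃) (Fin m₃) ℂ) (l₁ l₂ mu₁ mu₂ : ℂ) :
    Matrix (Fin m₃) (Fin m₃) ℂ :=
  (Lmat m₁ m₂ m₃)ᴴ * ((A1 m₁ m₂ m₃)ᴴ - mu₁ • 1)⁻¹ * ((A2 m₁ m₂ m₃)ᴴ - mu₂ • 1)⁻¹ *
    (Tmat m₁ m₂ m₃ t)⁻¹ * (A1 m₁ m₂ m₃ - l₁ • 1)⁻¹ * (A2 m₁ m₂ m₃ - l₂ • 1)⁻¹ *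
    Lmat m₁ m₂ m₃

/-- `v₁(μ) = ℒ^* (A₁^*-μ₁I)⁻¹ (A₂^*-μ₂I)⁻¹ Γ₁`. -/
def v1 (m₁ m₂ m₃ : ℕ) (t : ℤ → ℤ → Matrix (Fin m₃) (Fin m₃) ℂ) (mu₁ mu₂ : ℂ) :
    Matrix (Fin m₃) ((Fin m₂ × Fin m₃) ⊕ (Fin m₂ × Fin m₃)) ℂ :=
  (Lmat m₁ m₂ m₃)ᴴ * ((A1 m₁ m₂ m₃)ᴴ - mu₁ • 1)⁻¹ * ((A2 m₁ m₂ m₃)ᴴ - mu₂ • 1)⁻¹ *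
    Gamma1 m₁ m₂ m₃ t

/-- `v₂(μ) = ℒ^* (A₁^*-μ₁I)⁻¹ (A₂^*-μ₂I)⁻¹ Γ₂`. -/
def v2 (m₁ m₂ m₃ : ℕ) (t : ℤ → ℤ → Matrix (Fin m₃) (Fin m₃) ℂ) (mu₁ mu₂ : ℂ) :
    Matrix (Fin m₃) ((Fin m₁ × Fin m₃) ⊕ (Fin m₁ × Fin m₃)) ℂ :=
  (Lmat m₁ m₂ m₃)ᴴ * ((A1 m₁ m₂ m₃)ᴴ - mu₁ • 1)⁻¹ * ((A2 m₁ m₂ m₃)ᴴ - mu₂ • 1)⁻¹ *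
    Gamma2 m₁ m₂ m₃ t

/-- `v̂₁(λ) = Γ̂₁ (A₁-λ₁I)⁻¹ (A₂-λ₂I)⁻¹ ℒ`. -/
def vhat1 (m₁ m₂ m₃ : ℕ) (t : ℤ → ℤ → Matrix (Fin m₃) (Fin m₃) ℂ) (l₁ l₂ : ℂ) :
    Matrix ((Fin m₂ × Fin m₃) ⊕ (Fin m₂ × Fin m₃)) (Fin m₃) ℂ :=
  Gammahat1 m₁ m₂ m₃ t * (A1 m₁ m₂ m₃ - l₁ • 1)⁻¹ * (A2 m₁ m₂ m₃ - l₂ • 1)⁻¹ * Lmat m₁ m₂ m₃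

/-- `v̂₂(λ) = Γ̂₂ (A₁-λ₁I)⁻¹ (A₂-λ₂I)⁻¹ ℒ`. -/
def vhat2 (m₁ m₂ m₃ : ℕ) (t : ℤ → ℤ → Matrix (Fin m₃) (Fin m₃) ℂ) (l₁ l₂ : ℂ) :
    Matrix ((Fin m₁ × Fin m₃) ⊕ (Fin m₁ × Fin m₃)) (Fin m₃) ℂ :=
  Gammahat2 m₁ m₂ m₃ t * (A1 m₁ m₂ m₃ - l₁ • 1)⁻¹ * (A2 m₁ m₂ m₃ - l₂ • 1)⁻¹ * Lmat m₁ m₂ m₃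

/-- `u₁(μ) = v₁(μ) - i (1_{m₂}^* (𝒜₂^*-μ₂I)⁻¹ ⊗ I_{m₃}) [I_{m₂m₃} 0]`. -/
def u1 (m₁ m₂ m₃ : ℕ) (t : ℤ → ℤ → Matrix (Fin m₃) (Fin m₃) ℂ) (mu₁ mu₂ : ℂ) :
    Matrix (Fin m₃) ((Fin m₂ × Fin m₃) ⊕ (Fin m₂ × Fin m₃)) ℂ :=
  v1 m₁ m₂ m₃ t mu₁ mu₂ -
    Complex.I • Matrix.fromCols
      (rowKronId m₃ (Matrix.vecMul (fun _ : Fin m₂ => (1 : ℂ)) (((calA m₂)ᴴ - mu₂ • 1)⁻¹))) 0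

/-- `u₂(μ) = v₂(μ) - i (1_{m₁}^* (𝒜₁^*-μ₁I)⁻¹ ⊗ I_{m₃}) [I_{m₁m₃} 0]`. -/
def u2 (m₁ m₂ m₃ : ℕ) (t : ℤ → ℤ → Matrix (Fin m₃) (Fin m₃) ℂ) (mu₁ mu₂ : ℂ) :
    Matrix (Fin m₃) ((Fin m₁ × Fin m₃) ⊕ (Fin m₁ × Fin m₃)) ℂ :=
  v2 m₁ m₂ m₃ t mu₁ mu₂ -
    Complex.I • Matrix.fromCols
      (rowKronId m₃ (Matrix.vecMul (fun _ : Fin m₁ => (1 : ℂ)) (((calA m₁)ᴴ - mu₁ • 1)⁻¹))) 0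

/-- `û₁(λ) = v̂₁(λ) + i col[0; I_{m₂m₃}] ((𝒜₂-λ₂I)⁻¹ 1_{m₂} ⊗ I_{m₃})`. -/
def uhat1 (m₁ m₂ m₃ : ℕ) (t : ℤ → ℤ → Matrix (Fin m₃) (Fin m₃) ℂ) (l₁ l₂ : ℂ) :
    Matrix ((Fin m₂ × Fin m₃) ⊕ (Fin m₂ × Fin m₃)) (Fin m₃) ℂ :=
  vhat1 m₁ m₂ m₃ t l₁ l₂ +
    Complex.I • Matrix.fromRows 0
      (colKronId m₃ (Matrix.mulVec ((calA m₂ - l₂ • 1)⁻¹) (fun _ : Fin m₂ => (1 : ℂ))))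

/-- `û₂(λ) = v̂₂(λ) + i col[0; I_{m₁m₃}] ((𝒜₁-λ₁I)⁻¹ 1_{m₁} ⊗ I_{m₃})`. -/
def uhat2 (m₁ m₂ m₃ : ℕ) (t : ℤ → ℤ → Matrix (Fin m₃) (Fin m₃) ℂ) (l₁ l₂ : ℂ) :
    Matrix ((Fin m₁ × Fin m₃) ⊕ (Fin m₁ × Fin m₃)) (Fin m₃) ℂ :=
  vhat2 m₁ m₂ m₃ t l₁ l₂ +
    Complex.I • Matrix.fromRows 0
      (colKronId m₃ (Matrix.mulVec ((calA m₁ - l₁ • 1)⁻¹) (fun _ : Fin m₁ => (1 : ℂ))))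

/-- `K₁₁ = col [(1/2)M₄₂⁽⁰⁾, (1/2)M₄₂⁽⁰⁾+M₄₂⁽¹⁾, …]`. -/
def K11 (m₁ m₂ m₃ : ℕ) (t : ℤ → ℤ → Matrix (Fin m₃) (Fin m₃) ℂ) :
    Matrix (Fin m₁ × Fin m₃) (Fin m₂ × Fin m₃) ℂ :=
  Matrix.of fun y x =>
    ((2 : ℂ)⁻¹ • M42blk m₂ m₃ t 0 +
      ∑ j ∈ Finset.range (y.1 : ℕ), M42blk m₂ m₃ t ((j : ℤ) + 1)) y.2 x

/-- `K₁₂ = [(1/2)M₁₂⁽⁰⁾, (1/2)M₁₂⁽⁰⁾+M₁₂⁽⁻¹⁾, …]`. -/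
def K12 (m₁ m₂ m₃ : ℕ) (t : ℤ → ℤ → Matrix (Fin m₃) (Fin m₃) ℂ) :
    Matrix (Fin m₂ × Fin m₃) (Fin m₁ × Fin m₃) ℂ :=
  Matrix.of fun y x =>
    ((2 : ℂ)⁻¹ • M12blk m₂ m₃ t 0 +
      ∑ j ∈ Finset.range (x.1 : ℕ), M12blk m₂ m₃ t (-((j : ℤ) + 1))) y x.2

/-- `K = [(1/2)M₄₂⁽⁰⁾, (1/2)M₄₂⁽⁰⁾+M₄₂⁽⁻¹⁾, …]`. -/
def Kmat (m₁ m₂ m₃ : ℕ) (t : ℤ → ℤ → Matrix (Fin m₃) (Fin m₃) ℂ) :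
    Matrix (Fin m₃) (Idx m₁ m₂ m₃) ℂ :=
  Matrix.of fun l x =>
    ((2 : ℂ)⁻¹ • M42blk m₂ m₃ t 0 +
      ∑ j ∈ Finset.range (x.1.1 : ℕ), M42blk m₂ m₃ t (-((j : ℤ) + 1))) l (x.1.2, x.2)

/-- `N = col [(1/2)M₁₂⁽⁰⁾, (1/2)M₁₂⁽⁰⁾+M₁₂⁽¹⁾, …]`. -/
def Nmat (m₁ m₂ m₃ : ℕ) (t : ℤ → ℤ → Matrix (Fin m₃) (Fin m₃) ℂ) :
    Matrix (Idx m₁ m₂ m₃) (Fin m₃) ℂ :=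
  Matrix.of fun x l =>
    ((2 : ℂ)⁻¹ • M12blk m₂ m₃ t 0 +
      ∑ j ∈ Finset.range (x.1.1 : ℕ), M12blk m₂ m₃ t ((j : ℤ) + 1)) (x.1.2, x.2) l

/-- `diag {(𝒜-zI) ⊗ I_{m₃}, (𝒜-zI) ⊗ I_{m₃}}` (the diagonal blocks `G₁₁`, `G₂₂`). -/
def diagKron (n m₃ : ℕ) (z : ℂ) :
    Matrix ((Fin n × Fin m₃) ⊕ (Fin n × Fin m₃)) ((Fin n × Fin m₃) ⊕ (Fin n × Fin m₃)) ℂ :=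
  Matrix.fromBlocks ((calA n - z • 1) ⊗ₖ (1 : Matrix (Fin m₃) (Fin m₃) ℂ)) 0 0
    ((calA n - z • 1) ⊗ₖ (1 : Matrix (Fin m₃) (Fin m₃) ℂ))

/-- `diag {(𝒜^*-zI) ⊗ I_{m₃}, (𝒜^*-zI) ⊗ I_{m₃}}` (the diagonal blocks `E₁₁`, `E₂₂`). -/
def diagKronH (n m₃ : ℕ) (z : ℂ) :
    Matrix ((Fin n × Fin m₃) ⊕ (Fin n × Fin m₃)) ((Fin n × Fin m₃) ⊕ (Fin n × Fin m₃)) ℂ :=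
  Matrix.fromBlocks (((calA n)ᴴ - z • 1) ⊗ₖ (1 : Matrix (Fin m₃) (Fin m₃) ℂ)) 0 0
    (((calA n)ᴴ - z • 1) ⊗ₖ (1 : Matrix (Fin m₃) (Fin m₃) ℂ))

/-- `𝔄(z) = diag {(𝒜^*-zI) ⊗ I_{m₃}, (𝒜-zI) ⊗ I_{m₃}}`. -/
def frakA (n m₃ : ℕ) (z : ℂ) :
    Matrix ((Fin n × Fin m₃) ⊕ (Fin n × Fin m₃)) ((Fin n × Fin m₃) ⊕ (Fin n × Fin m₃)) ℂ :=
  Matrix.fromBlocks (((calA n)ᴴ - z • 1) ⊗ₖ (1 : Matrix (Fin m₃) (Fin m₃) ℂ)) 0 0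
    ((calA n - z • 1) ⊗ₖ (1 : Matrix (Fin m₃) (Fin m₃) ℂ))

/-- `G₁₂ = i (Π̂₁ Γ₂ - [[ℒ₂ℒ₁^*, 0], [K₁₂, 0]])`. -/
def G12 (m₁ m₂ m₃ : ℕ) (t : ℤ → ℤ → Matrix (Fin m₃) (Fin m₃) ℂ) :
    Matrix ((Fin m₂ × Fin m₃) ⊕ (Fin m₂ × Fin m₃)) ((Fin m₁ × Fin m₃) ⊕ (Fin m₁ × Fin m₃)) ℂ :=
  Complex.I • (Pihat1 m₁ m₂ m₃ t * Gamma2 m₁ m₂ m₃ t -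
    Matrix.fromBlocks (Lp m₂ m₃ * (Lp m₁ m₃)ᴴ) 0 (K12 m₁ m₂ m₃ t) 0)

/-- `G₂₁ = i (Π̂₂ Γ₁ - [[ℒ₁ℒ₂^*, 0], [K₁₁, 0]])`. -/
def G21 (m₁ m₂ m₃ : ℕ) (t : ℤ → ℤ → Matrix (Fin m₃) (Fin m₃) ℂ) :
    Matrix ((Fin m₁ × Fin m₃) ⊕ (Fin m₁ × Fin m₃)) ((Fin m₂ × Fin m₃) ⊕ (Fin m₂ × Fin m₃)) ℂ :=
  Complex.I • (Pihat2 m₁ m₂ m₃ t * Gamma1 m₁ m₂ m₃ t -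
    Matrix.fromBlocks (Lp m₁ m₃ * (Lp m₂ m₃)ᴴ) 0 (K11 m₁ m₂ m₃ t) 0)

/-- `G(λ) = [[G₁₁(λ₂), G₁₂], [G₂₁, G₂₂(λ₁)]]`. -/
def Gmat (m₁ m₂ m₃ : ℕ) (t : ℤ → ℤ → Matrix (Fin m₃) (Fin m₃) ℂ) (l₁ l₂ : ℂ) :
    Matrix ((((Fin m₂ × Fin m₃) ⊕ (Fin m₂ × Fin m₃))) ⊕ (((Fin m₁ × Fin m₃) ⊕ (Fin m₁ × Fin m₃))))
      ((((Fin m₂ × Fin m₃) ⊕ (Fin m₂ × Fin m₃))) ⊕ (((Fin m₁ × Fin m₃) ⊕ (Fin m₁ × Fin m₃)))) ℂ :=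
  Matrix.fromBlocks (diagKron m₂ m₃ l₂) (G12 m₁ m₂ m₃ t) (G21 m₁ m₂ m₃ t) (diagKron m₁ m₃ l₁)

/-- `E₁₂ = -i (Π̂₁ Γ₂ - [[0, 0], [K₁₂, ℒ₂ℒ₁^*]])`. -/
def E12m (m₁ m₂ m₃ : ℕ) (t : ℤ → ℤ → Matrix (Fin m₃) (Fin m₃) ℂ) :
    Matrix ((Fin m₂ × Fin m₃) ⊕ (Fin m₂ × Fin m₃)) ((Fin m₁ × Fin m₃) ⊕ (Fin m₁ × Fin m₃)) ℂ :=
  (-Complex.I) • (Pihat1 m₁ m₂ m₃ t * Gamma2 m₁ m₂ m₃ t -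
    Matrix.fromBlocks 0 0 (K12 m₁ m₂ m₃ t) (Lp m₂ m₃ * (Lp m₁ m₃)ᴴ))

/-- `E₂₁ = -i (Π̂₂ Γ₁ - [[0, 0], [K₁₁, ℒ₁ℒ₂^*]])`. -/
def E21m (m₁ m₂ m₃ : ℕ) (t : ℤ → ℤ → Matrix (Fin m₃) (Fin m₃) ℂ) :
    Matrix ((Fin m₁ × Fin m₃) ⊕ (Fin m₁ × Fin m₃)) ((Fin m₂ × Fin m₃) ⊕ (Fin m₂ × Fin m₃)) ℂ :=
  (-Complex.I) • (Pihat2 m₁ m₂ m₃ t * Gamma1 m₁ m₂ m₃ t -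
    Matrix.fromBlocks 0 0 (K11 m₁ m₂ m₃ t) (Lp m₁ m₃ * (Lp m₂ m₃)ᴴ))

/-- `E(μ) = [[E₁₁(μ₂), E₁₂], [E₂₁, E₂₂(μ₁)]]`. -/
def Emat (m₁ m₂ m₃ : ℕ) (t : ℤ → ℤ → Matrix (Fin m₃) (Fin m₃) ℂ) (mu₁ mu₂ : ℂ) :
    Matrix ((((Fin m₂ × Fin m₃) ⊕ (Fin m₂ × Fin m₃))) ⊕ (((Fin m₁ × Fin m₃) ⊕ (Fin m₁ × Fin m₃))))
      ((((Fin m₂ × Fin m₃) ⊕ (Fin m₂ × Fin m₃))) ⊕ (((Fin m₁ × Fin m₃) ⊕ (Fin m₁ × Fin m₃)))) ℂ :=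
  Matrix.fromBlocks (diagKronH m₂ m₃ mu₂) (E12m m₁ m₂ m₃ t) (E21m m₁ m₂ m₃ t) (diagKronH m₁ m₃ mu₁)

/-- `θ(λ) = i (I_{m₃} + K R (A₁-λ₁I)⁻¹ (A₂-λ₂I)⁻¹ ℒ)`. -/
def theta (m₁ m₂ m₃ : ℕ) (t : ℤ → ℤ → Matrix (Fin m₃) (Fin m₃) ℂ) (l₁ l₂ : ℂ) :
    Matrix (Fin m₃) (Fin m₃) ℂ :=
  Complex.I • (1 + Kmat m₁ m₂ m₃ t * (Tmat m₁ m₂ m₃ t)⁻¹ *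
    (A1 m₁ m₂ m₃ - l₁ • 1)⁻¹ * (A2 m₁ m₂ m₃ - l₂ • 1)⁻¹ * Lmat m₁ m₂ m₃)

/-- `ϑ(μ) = -i (I_{m₃} + ℒ^* (A₁^*-μ₁I)⁻¹ (A₂^*-μ₂I)⁻¹ R N)`. -/
def vartheta (m₁ m₂ m₃ : ℕ) (t : ℤ → ℤ → Matrix (Fin m₃) (Fin m₃) ℂ) (mu₁ mu₂ : ℂ) :
    Matrix (Fin m₃) (Fin m₃) ℂ :=
  (-Complex.I) • (1 + (Lmat m₁ m₂ m₃)ᴴ * ((A1 m₁ m₂ m₃)ᴴ - mu₁ • 1)⁻¹ *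
    ((A2 m₁ m₂ m₃)ᴴ - mu₂ • 1)⁻¹ * (Tmat m₁ m₂ m₃ t)⁻¹ * Nmat m₁ m₂ m₃ t)

/-- The exchange (anti-diagonal) matrix `U_n = {δ_{n-i-k+1}}`. -/
def Up (n : ℕ) : Matrix (Fin n) (Fin n) ℂ :=
  Matrix.of fun i k => if (i : ℕ) + (k : ℕ) + 1 = n then 1 else 0

/-- `U = U₁ ⊗ U₂ ⊗ U₃`. -/
def Umat (m₁ m₂ m₃ : ℕ) : Matrix (Idx m₁ m₂ m₃) (Idx m₁ m₂ m₃) ℂ :=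
  (Up m₁ ⊗ₖ Up m₂) ⊗ₖ Up m₃

/-- `Ũ_k = [[0, -(U_k ⊗ U₃)], [U_k ⊗ U₃, 0]]`. -/
def Utilde (n m₃ : ℕ) :
    Matrix ((Fin n × Fin m₃) ⊕ (Fin n × Fin m₃)) ((Fin n × Fin m₃) ⊕ (Fin n × Fin m₃)) ℂ :=
  Matrix.fromBlocks 0 (-(Up n ⊗ₖ Up m₃)) (Up n ⊗ₖ Up m₃) 0

/-- The DSTU property: `U₃ t_j^{(r)} U₃ = (t_j^{(r)})ᵀ` for all blocks. -/
def DSTU (m₃ : ℕ) (t : ℤ → ℤ → Matrix (Fin m₃) (Fin m₃) ℂ) : Prop :=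
  ∀ r j : ℤ, Up m₃ * t r j * Up m₃ = (t r j)ᵀ

/-- `q(μ) = ((μ₁-i/2)/(μ₁+i/2))^{m₁} ((μ₂-i/2)/(μ₂+i/2))^{m₂}`. -/
def qfun (m₁ m₂ : ℕ) (mu₁ mu₂ : ℂ) : ℂ :=
  ((mu₁ - Complex.I / 2) / (mu₁ + Complex.I / 2)) ^ m₁ *
    ((mu₂ - Complex.I / 2) / (mu₂ + Complex.I / 2)) ^ m₂

/-- helper functional -/
def PP (n : ℕ) (f : ℤ → ℂ) : ℂ := 2⁻¹ * f 0 + ∑ s ∈ Finset.range n, f ((s : ℤ) + 1)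

/-- helper functional -/
def NN (n : ℕ) (f : ℤ → ℂ) : ℂ := 2⁻¹ * f 0 + ∑ s ∈ Finset.range n, f (-((s : ℤ) + 1))

theorem PP_add (n : ℕ) (f g : ℤ → ℂ) : PP n (fun r => f r + g r) = PP n f + PP n g := by
  simp only [PP, Finset.sum_add_distrib]; ring

theorem NN_add (n : ℕ) (f g : ℤ → ℂ) : NN n (fun r => f r + g r) = NN n f + NN n g := by
  simp only [NN, Finset.sum_add_distrib]; ring

theorem PP_sum {ι : Type*} [Fintype ι] (n : ℕ) (f : ι → ℤ → ℂ) :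
    ∑ k, PP n (f k) = PP n (fun r => ∑ k, f k r) := by
  simp only [PP, Finset.sum_add_distrib, Finset.mul_sum]
  rw [Finset.sum_comm]

theorem NN_sum {ι : Type*} [Fintype ι] (n : ℕ) (f : ι → ℤ → ℂ) :
    ∑ k, NN n (f k) = NN n (fun r => ∑ k, f k r) := by
  simp only [NN, Finset.sum_add_distrib, Finset.mul_sum]
  rw [Finset.sum_comm]

theorem key0 (a b : ℕ) (f : ℤ → ℂ) :
    ∑ k ∈ Finset.range (a + 1 + b), f ((a : ℤ) - k) = PP a f + NN b f := by
  rw [Finset.sum_range_add, Finset.sum_range_succ]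
  have h1 : ∑ k ∈ Finset.range a, f ((a : ℤ) - k) = ∑ s ∈ Finset.range a, f ((s : ℤ) + 1) := by
    rw [← Finset.sum_range_reflect]
    apply Finset.sum_congr rfl
    intro k hk
    congr 1
    have := Finset.mem_range.1 hk
    omega
  have h2 : ∑ k ∈ Finset.range b, f ((a : ℤ) - ((a + 1 + k : ℕ) : ℤ))
      = ∑ s ∈ Finset.range b, f (-((s : ℤ) + 1)) := by
    apply Finset.sum_congr rfl
    intro k hk
    congr 1
    push_cast
    ring
  rw [h1, h2, PP, NN, sub_self]
  ring

theorem keyP {n : ℕ} (i : Fin n) (f : ℤ → ℂ) :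
    ∑ k : Fin n, f (((i : ℕ) : ℤ) - ((k : ℕ) : ℤ)) = PP i f + NN (Fin.rev i) f := by
  rw [← key0, Fin.sum_univ_eq_sum_range (fun k => f (((i : ℕ) : ℤ) - (k : ℤ)))]
  congr 2
  have := i.2
  simp [Fin.val_rev]

theorem keyN {n : ℕ} (i : Fin n) (f : ℤ → ℂ) :
    ∑ k : Fin n, f (((k : ℕ) : ℤ) - ((i : ℕ) : ℤ)) = NN i f + PP (Fin.rev i) f := by
  have := keyP i (fun z => f (-z))
  simpa [PP, NN] using this

theorem rev_sub {n : ℕ} (a b : Fin n) :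
    (((Fin.rev a : Fin n) : ℕ) : ℤ) - (((Fin.rev b : Fin n) : ℕ) : ℤ)
      = ((b : ℕ) : ℤ) - ((a : ℕ) : ℤ) := by
  simp only [Fin.val_rev]; omega

theorem Up_apply {n : ℕ} (i k : Fin n) : Up n i k = if k = Fin.rev i then 1 else 0 := by
  simp only [Up, Matrix.of_apply]
  congr 1
  have := i.2
  have := k.2
  simp only [Fin.ext_iff, Fin.val_rev, eq_iff_iff]
  omega

theorem Up_mul_apply {n : ℕ} {ι : Type*} (X : Matrix (Fin n) ι ℂ) (i : Fin n) (y : ι) :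
    (Up n * X) i y = X (Fin.rev i) y := by
  simp [Matrix.mul_apply, Up_apply]

theorem mul_Up_apply {n : ℕ} {ι : Type*} (X : Matrix ι (Fin n) ℂ) (i : Fin n) (y : ι) :
    (X * Up n) y i = X y (Fin.rev i) := by
  have h : ∀ j : Fin n, i = Fin.rev j ↔ j = Fin.rev i := by
    intro j; constructor <;> (rintro rfl; simp)
  simp [Matrix.mul_apply, Up_apply, h]

/-- reversal on pairs -/
def rv2 {a b : ℕ} (x : Fin a × Fin b) : Fin a × Fin b := (Fin.rev x.1, Fin.rev x.2)

theorem rv2_rv2 {a b : ℕ} (x : Fin a × Fin b) : rv2 (rv2 x) = x := by simp [rv2]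

/-- reversal on triples -/
def rv3 {a b c : ℕ} (x : Idx a b c) : Idx a b c := (rv2 x.1, Fin.rev x.2)

theorem rv3_rv3 {a b c : ℕ} (x : Idx a b c) : rv3 (rv3 x) = x := by simp [rv2, rv3]

theorem U2_apply {a b : ℕ} (x y : Fin a × Fin b) :
    (Up a ⊗ₖ Up b) x y = if y = rv2 x then 1 else 0 := by
  simp only [Matrix.kroneckerMap_apply, Up_apply, rv2, Prod.ext_iff]
  split_ifs <;> simp_all

theorem U3_apply {a b c : ℕ} (x y : Idx a b c) :
    (Umat a b c) x y = if y = rv3 x then 1 else 0 := by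
  rw [Umat, Matrix.kroneckerMap_apply, U2_apply, Up_apply]
  simp only [rv3, Prod.ext_iff]
  split_ifs <;> simp_all

theorem U2_mul {a b : ℕ} {ι : Type*} (X : Matrix (Fin a × Fin b) ι ℂ) (x : Fin a × Fin b) (y : ι) :
    ((Up a ⊗ₖ Up b) * X) x y = X (rv2 x) y := by
  simp only [Matrix.mul_apply, U2_apply]
  simp

theorem mul_U2 {a b : ℕ} {ι : Type*} (X : Matrix ι (Fin a × Fin b) ℂ) (x : Fin a × Fin b) (y : ι) :
    (X * (Up a ⊗ₖ Up b)) y x = X y (rv2 x) := by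
  have h : ∀ j : Fin a × Fin b, x = rv2 j ↔ j = rv2 x := by
    intro j; constructor <;> (rintro rfl; simp [rv2_rv2])
  simp only [Matrix.mul_apply, U2_apply, h]
  simp

theorem U3_mul {a b c : ℕ} {ι : Type*} (X : Matrix (Idx a b c) ι ℂ) (x : Idx a b c) (y : ι) :
    (Umat a b c * X) x y = X (rv3 x) y := by
  simp only [Matrix.mul_apply, U3_apply]
  simp

theorem mul_U3 {a b c : ℕ} {ι : Type*} (X : Matrix ι (Idx a b c) ℂ) (x : Idx a b c) (y : ι) :
    (X * Umat a b c) y x = X y (rv3 x) := by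
  have h : ∀ j : Idx a b c, x = rv3 j ↔ j = rv3 x := by
    intro j; constructor <;> (rintro rfl; simp [rv3_rv3])
  simp only [Matrix.mul_apply, U3_apply, h]
  simp

theorem U3_sq (a b c : ℕ) : Umat a b c * Umat a b c = 1 := by
  ext x y
  rw [U3_mul, U3_apply, rv3_rv3, Matrix.one_apply]
  simp [eq_comm]

theorem dstu_apply {m₃ : ℕ} {t : ℤ → ℤ → Matrix (Fin m₃) (Fin m₃) ℂ} (hD : DSTU m₃ t)
    (r j : ℤ) (k l : Fin m₃) : t r j (Fin.rev l) (Fin.rev k) = t r j k l := by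
  have := congrFun (congrFun (hD r j) l) k
  rw [mul_Up_apply, Up_mul_apply] at this
  simpa using this

section
variable {m₁ m₂ m₃ : ℕ} {t : ℤ → ℤ → Matrix (Fin m₃) (Fin m₃) ℂ}

theorem M11_apply (x : Idx m₁ m₂ m₃) (y : Fin m₂ × Fin m₃) :
    M11 m₁ m₂ m₃ t x y =
      PP x.1.1 (fun r => t r (((x.1.2 : ℕ) : ℤ) - ((y.1 : ℕ) : ℤ)) x.2 y.2) := by
  simp [M11, PP, Matrix.sum_apply, calT]

theorem M41_apply (x : Idx m₁ m₂ m₃) (y : Fin m₂ × Fin m₃) :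
    M41 m₁ m₂ m₃ t y x =
      NN x.1.1 (fun r => t r (((y.1 : ℕ) : ℤ) - ((x.1.2 : ℕ) : ℤ)) y.2 x.2) := by
  simp [M41, NN, Matrix.sum_apply, calT]

theorem M12_apply (x : Idx m₁ m₂ m₃) (y : Fin m₁ × Fin m₃) :
    M12 m₁ m₂ m₃ t x y =
      PP x.1.2 (fun s => t (((x.1.1 : ℕ) : ℤ) - ((y.1 : ℕ) : ℤ)) s x.2 y.2) := by
  simp [M12, M12blk, PP, Matrix.sum_apply]

theorem M42_apply (x : Idx m₁ m₂ m₃) (y : Fin m₁ × Fin m₃) :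
    M42 m₁ m₂ m₃ t y x =
      NN x.1.2 (fun s => t (((y.1 : ℕ) : ℤ) - ((x.1.1 : ℕ) : ℤ)) s y.2 x.2) := by
  simp [M42, M42blk, NN, Matrix.sum_apply]

theorem K11_apply (y : Fin m₁ × Fin m₃) (x : Fin m₂ × Fin m₃) :
    K11 m₁ m₂ m₃ t y x = PP y.1 (fun r => NN x.1 (fun s => t r s y.2 x.2)) := by
  simp [K11, M42blk, PP, NN, Matrix.sum_apply]

theorem K12_apply (y : Fin m₂ × Fin m₃) (x : Fin m₁ × Fin m₃) :
    K12 m₁ m₂ m₃ t y x = NN x.1 (fun r => PP y.1 (fun s => t r s y.2 x.2)) := by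
  simp [K12, M12blk, PP, NN, Matrix.sum_apply]

theorem mul_M31_apply {ι : Type*} (X : Matrix ι (Idx m₁ m₂ m₃) ℂ) (i : ι) (y : Fin m₂ × Fin m₃) :
    (X * M31 m₁ m₂ m₃) i y = ∑ k : Fin m₁, X i ((k, y.1), y.2) := by
  rw [Matrix.mul_apply, Fintype.sum_prod_type, Fintype.sum_prod_type]
  simp [M31, M21, ite_and, apply_ite]

theorem M22_mul_apply {ι : Type*} (X : Matrix (Idx m₁ m₂ m₃) ι ℂ) (i : ι) (y : Fin m₁ × Fin m₃) :
    (M22 m₁ m₂ m₃ * X) y i = ∑ k : Fin m₂, X ((y.1, k), y.2) i := by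
  rw [Matrix.mul_apply, Fintype.sum_prod_type, Fintype.sum_prod_type]
  simp [M22, ite_and]

theorem M22_M31 : M22 m₁ m₂ m₃ * M31 m₁ m₂ m₃ = Lp m₁ m₃ * (Lp m₂ m₃)ᴴ := by
  ext x y
  rw [mul_M31_apply]
  simp [M22, Lp, Matrix.mul_apply, ite_and, apply_ite, eq_comm]

theorem T_trans (hD : DSTU m₃ t) :
    (Tmat m₁ m₂ m₃ t)ᵀ = Umat m₁ m₂ m₃ * Tmat m₁ m₂ m₃ t * Umat m₁ m₂ m₃ := by
  ext x y
  rw [mul_U3, U3_mul]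
  simp only [Matrix.transpose_apply, Tmat, Matrix.of_apply, rv3, rv2, dstu_apply hD, rev_sub]

theorem R_trans (hD : DSTU m₃ t) :
    ((Tmat m₁ m₂ m₃ t)⁻¹)ᵀ = Umat m₁ m₂ m₃ * (Tmat m₁ m₂ m₃ t)⁻¹ * Umat m₁ m₂ m₃ := by
  rw [Matrix.transpose_nonsing_inv, T_trans hD, Matrix.mul_inv_rev, Matrix.mul_inv_rev,
    Matrix.inv_eq_left_inv (U3_sq m₁ m₂ m₃), Matrix.mul_assoc]

theorem eqA (hD : DSTU m₃ t) :
    Umat m₁ m₂ m₃ * (M41 m₁ m₂ m₃ t)ᵀ * (Up m₂ ⊗ₖ Up m₃)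
      = Tmat m₁ m₂ m₃ t * M31 m₁ m₂ m₃ - M11 m₁ m₂ m₃ t := by
  ext x y
  rw [mul_U2, U3_mul, Matrix.transpose_apply, M41_apply, Matrix.sub_apply, M11_apply,
    mul_M31_apply]
  simp only [Tmat, Matrix.of_apply, rv3, rv2, dstu_apply hD]
  rw [keyP x.1.1 (fun r => t r (((x.1.2 : ℕ) : ℤ) - ((y.1 : ℕ) : ℤ)) x.2 y.2)]
  rw [add_sub_cancel_left]
  have : (((Fin.rev y.1 : Fin m₂) : ℕ) : ℤ) - (((Fin.rev x.1.2 : Fin m₂) : ℕ) : ℤ)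
      = ((x.1.2 : ℕ) : ℤ) - ((y.1 : ℕ) : ℤ) := by
    simp only [Fin.val_rev]; omega
  rw [this]

theorem eqB (hD : DSTU m₃ t) :
    (Up m₁ ⊗ₖ Up m₃) * (M12 m₁ m₂ m₃ t)ᵀ * Umat m₁ m₂ m₃
      = M22 m₁ m₂ m₃ * Tmat m₁ m₂ m₃ t - M42 m₁ m₂ m₃ t := by
  ext y x
  rw [mul_U3, U2_mul, Matrix.transpose_apply, M12_apply, Matrix.sub_apply, M42_apply,
    M22_mul_apply]
  simp only [Tmat, Matrix.of_apply, rv3, rv2, dstu_apply hD]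
  rw [keyN x.1.2 (fun s => t (((y.1 : ℕ) : ℤ) - ((x.1.1 : ℕ) : ℤ)) s y.2 x.2)]
  rw [add_sub_cancel_left]
  have : (((Fin.rev x.1.1 : Fin m₁) : ℕ) : ℤ) - (((Fin.rev y.1 : Fin m₁) : ℕ) : ℤ)
      = ((y.1 : ℕ) : ℤ) - ((x.1.1 : ℕ) : ℤ) := by
    simp only [Fin.val_rev]; omega
  rw [this]

theorem eqC : (Up m₁ ⊗ₖ Up m₃) * (M32 m₁ m₂ m₃)ᵀ * Umat m₁ m₂ m₃ = M22 m₁ m₂ m₃ := by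
  ext y x
  rw [mul_U3, U2_mul]
  simp [M32, M22, rv2, rv3, apply_ite]

theorem eqD : Umat m₁ m₂ m₃ * (M21 m₁ m₂ m₃)ᵀ * (Up m₂ ⊗ₖ Up m₃) = M31 m₁ m₂ m₃ := by
  ext y x
  rw [mul_U2, U3_mul]
  simp [M31, M21, rv2, rv3, apply_ite]

theorem eqL : (Up m₁ ⊗ₖ Up m₃) * (Lp m₂ m₃ * (Lp m₁ m₃)ᴴ)ᵀ * (Up m₂ ⊗ₖ Up m₃)
    = Lp m₁ m₃ * (Lp m₂ m₃)ᴴ := by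
  ext y x
  rw [mul_U2, U2_mul]
  simp [Lp, Matrix.mul_apply, rv2, apply_ite, eq_comm]

theorem eqK (hD : DSTU m₃ t) :
    (Up m₁ ⊗ₖ Up m₃) * (K12 m₁ m₂ m₃ t)ᵀ * (Up m₂ ⊗ₖ Up m₃)
      = K11 m₁ m₂ m₃ t + M22 m₁ m₂ m₃ * Tmat m₁ m₂ m₃ t * M31 m₁ m₂ m₃
        - M22 m₁ m₂ m₃ * M11 m₁ m₂ m₃ t - M42 m₁ m₂ m₃ t * M31 m₁ m₂ m₃ := by
  ext y x
  rw [mul_U2, U2_mul, Matrix.transpose_apply, K12_apply]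
  simp only [Matrix.sub_apply, Matrix.add_apply, mul_M31_apply, M22_mul_apply, K11_apply,
    M11_apply, M42_apply, Tmat, Matrix.of_apply, rv2, dstu_apply hD]
  have hN : ∀ r : ℤ, ∑ k : Fin m₂, t r (((k : ℕ) : ℤ) - ((x.1 : ℕ) : ℤ)) y.2 x.2 =
      NN x.1 (fun s => t r s y.2 x.2) + PP (Fin.rev x.1) (fun s => t r s y.2 x.2) :=
    fun r => keyN x.1 (fun s => t r s y.2 x.2)
  simp only [PP_sum, hN]
  rw [keyP y.1 (fun r => NN x.1 (fun s => t r s y.2 x.2) +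
      PP (Fin.rev x.1) (fun s => t r s y.2 x.2)),
    keyP y.1 (fun r => NN x.1 (fun s => t r s y.2 x.2))]
  simp only [PP_add, NN_add]
  ring

theorem conj_aux2 (hD : DSTU m₃ t) {p q : Type*} [Fintype p] [Fintype q]
    (A : Matrix p p ℂ) (B : Matrix q q ℂ) (X : Matrix (Idx m₁ m₂ m₃) p ℂ)
    (Y : Matrix q (Idx m₁ m₂ m₃) ℂ) :
    A * (Y * ((Tmat m₁ m₂ m₃ t)⁻¹ * X))ᵀ * B =
      (A * Xᵀ * Umat m₁ m₂ m₃) * (Tmat m₁ m₂ m₃ t)⁻¹ * (Umat m₁ m₂ m₃ * Yᵀ * B) := by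
  rw [Matrix.transpose_mul, Matrix.transpose_mul, R_trans hD]
  simp only [Matrix.mul_assoc]

end

theorem fromBlocks_sub_aux {p q r s : Type*} (A A' : Matrix p r ℂ) (B B' : Matrix p s ℂ)
    (C C' : Matrix q r ℂ) (D D' : Matrix q s ℂ) :
    Matrix.fromBlocks A B C D - Matrix.fromBlocks A' B' C' D'
      = Matrix.fromBlocks (A - A') (B - B') (C - C') (D - D') := by
  ext (i | i) (j | j) <;> simp

theorem blk_aux {p q r s n : Type*} [Fintype n] (A : Matrix p n ℂ) (B : Matrix q n ℂ)
    (R : Matrix n n ℂ) (C : Matrix n r ℂ) (D : Matrix n s ℂ) :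
    Matrix.fromRows A B * (R * Matrix.fromCols C D)
      = Matrix.fromBlocks (A * (R * C)) (A * (R * D)) (B * (R * C)) (B * (R * D)) := by
  rw [Matrix.mul_fromCols, Matrix.fromRows_mul_fromCols]

/-- Theorem 4.1, second part: For an invertible DSTU block TBT-matrix `T`,
`G₂₁ = Ũ₁ G₁₂ᵀ Ũ₂`. -/
theorem statement19 (m₁ m₂ m₃ : ℕ) (hm₁ : 2 ≤ m₁) (hm₂ : 2 ≤ m₂) (hm₃ : 2 ≤ m₃)
    (t : ℤ → ℤ → Matrix (Fin m₃) (Fin m₃) ℂ) (hD : DSTU m₃ t)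
    (hT : IsUnit (Tmat m₁ m₂ m₃ t)) :
    G21 m₁ m₂ m₃ t = Utilde m₁ m₃ * (G12 m₁ m₂ m₃ t)ᵀ * Utilde m₂ m₃ := by
  have hdet : IsUnit (Tmat m₁ m₂ m₃ t).det := (Matrix.isUnit_iff_isUnit_det _).1 hT
  have hTR : ∀ {p : Type} (X : Matrix (Idx m₁ m₂ m₃) p ℂ),
      Tmat m₁ m₂ m₃ t * ((Tmat m₁ m₂ m₃ t)⁻¹ * X) = X := fun X => by
    rw [← Matrix.mul_assoc, Matrix.mul_nonsing_inv _ hdet, Matrix.one_mul]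
  have hRT : ∀ {p : Type} (X : Matrix (Idx m₁ m₂ m₃) p ℂ),
      (Tmat m₁ m₂ m₃ t)⁻¹ * (Tmat m₁ m₂ m₃ t * X) = X := fun X => by
    rw [← Matrix.mul_assoc, Matrix.nonsing_inv_mul _ hdet, Matrix.one_mul]
  have a1 := conj_aux2 hD (Up m₁ ⊗ₖ Up m₃) (Up m₂ ⊗ₖ Up m₃) (M32 m₁ m₂ m₃) (M41 m₁ m₂ m₃ t)
  have a2 := conj_aux2 hD (Up m₁ ⊗ₖ Up m₃) (Up m₂ ⊗ₖ Up m₃) (M32 m₁ m₂ m₃) (M21 m₁ m₂ m₃)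
  have a3 := conj_aux2 hD (Up m₁ ⊗ₖ Up m₃) (Up m₂ ⊗ₖ Up m₃) (M12 m₁ m₂ m₃ t) (M41 m₁ m₂ m₃ t)
  have a4 := conj_aux2 hD (Up m₁ ⊗ₖ Up m₃) (Up m₂ ⊗ₖ Up m₃) (M12 m₁ m₂ m₃ t) (M21 m₁ m₂ m₃)
  rw [eqC, eqA hD] at a1
  rw [eqC, eqD] at a2
  rw [eqB hD, eqA hD] at a3
  rw [eqB hD, eqD] at a4
  have hL := eqL (m₁ := m₁) (m₂ := m₂) (m₃ := m₃)
  have hK := eqK (m₁ := m₁) (m₂ := m₂) hD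
  rw [G21, G12, Utilde, Utilde, Matrix.transpose_smul, Matrix.mul_smul, Matrix.smul_mul]
  congr 1
  simp only [Pihat1, Pihat2, Gamma1, Gamma2, Pi1, Pi2, blk_aux,
    fromBlocks_sub_aux, Matrix.transpose_zero, Matrix.fromBlocks_transpose,
    Matrix.fromBlocks_multiply, Matrix.zero_mul, Matrix.mul_zero, zero_add, add_zero,
    sub_zero, Matrix.neg_mul, Matrix.mul_neg, neg_neg, Matrix.transpose_sub, Matrix.mul_sub,
    Matrix.sub_mul, a1, a2, a3, a4, hL, hK]
  simp only [Matrix.mul_assoc, hTR, hRT, M22_M31]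
  congr 1 <;> abel

end TBT
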